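/- arXiv:2506.06947 — 2 statements merged into one kernel-verified Lean document; each statement's English description precedes it below -/
import Mathlib

section
/- For every ξ ∈ ℝ^d and every integer n ≥ 1, the function η ↦ K(ξ,η)·(φ_n(|η|)⟨η⟩^{−2δ} − φ_n(|ξ|)⟨ξ⟩^{−2δ}) is Lebesgue integrable on ℝ^d, and the same holds with φ_n replaced by the constant function 1; moreover, for every ξ ∈ ℝ^d \ {0} and every integer n ≥ 1, the function η ↦ K(ξ,η)·(φ_n(|η|)|η|^{−2δ} − φ_n(|ξ|)|ξ|^{−2δ}) is Lebesgue integrable on ℝ^d, and again the same holds with φ_n replaced by the constant function 1. Consequently F^n(ξ) and F(ξ) are well-defined for all ξ ∈ ℝ^d, and Ḟ^n(ξ) and Ḟ(ξ) are well-defined for all ξ ≠ 0. -/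
open MeasureTheory Real

noncomputable section

/-- Orthogonal projection of `w` onto the orthogonal complement of `span {v}`
(for `v = 0` this formula returns `w` itself, an irrelevant convention). -/
def Pperp (d : ℕ) (v w : EuclideanSpace ℝ (Fin d)) : EuclideanSpace ℝ (Fin d) :=
  w - (((inner ℝ v w : ℝ)) / ‖v‖ ^ 2) • v

/-- Japanese bracket `⟨ξ⟩ = (1 + |ξ|²)^{1/2}`. -/
def jb (d : ℕ) (ξ : EuclideanSpace ℝ (Fin d)) : ℝ := Real.sqrt (1 + ‖ξ‖ ^ 2)

/-- The kernel `K(ξ,η) = |P⊥_{ξ-η} ξ|² ⟨ξ-η⟩^{-(d+2α)}`. -/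
def Kker (d : ℕ) (α : ℝ) (ξ η : EuclideanSpace ℝ (Fin d)) : ℝ :=
  ‖Pperp d (ξ - η) ξ‖ ^ 2 * jb d (ξ - η) ^ (-((d : ℝ) + 2 * α))

/-- `φ_n(r) := φ(r/n)`. -/
def phin (φ : ℝ → ℝ) (n : ℕ) (r : ℝ) : ℝ := φ (r / n)

/-- The projection is a contraction. -/
lemma Pperp_norm_sq_le (d : ℕ) (v w : EuclideanSpace ℝ (Fin d)) :
    ‖Pperp d v w‖ ^ 2 ≤ ‖w‖ ^ 2 := by
  unfold Pperp
  by_cases hv : v = 0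
  · simp [hv]
  have hv' : 0 < ‖v‖ ^ 2 := by positivity
  rw [norm_sub_sq_real, inner_smul_right, norm_smul, mul_pow, Real.norm_eq_abs, sq_abs,
    real_inner_comm v w]
  have : (inner ℝ v w / ‖v‖ ^ 2) ^ 2 * ‖v‖ ^ 2
      = inner ℝ v w / ‖v‖ ^ 2 * inner ℝ v w := by
    field_simp
  rw [this]
  have h2 : 0 ≤ inner ℝ v w / ‖v‖ ^ 2 * inner ℝ v w := by
    rw [div_mul_eq_mul_div]
    exact div_nonneg (mul_self_nonneg _) hv'.le
  linarith

lemma jb_one_le (d : ℕ) (x : EuclideanSpace ℝ (Fin d)) : 1 ≤ jb d x := by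
  unfold jb
  rw [Real.one_le_sqrt]
  nlinarith [sq_nonneg ‖x‖]

lemma jb_rpow_le_one (d : ℕ) (x : EuclideanSpace ℝ (Fin d)) {s : ℝ} (hs : s ≤ 0) :
    jb d x ^ s ≤ 1 := Real.rpow_le_one_of_one_le_of_nonpos (jb_one_le d x) hs

lemma jb_rpow_nonneg (d : ℕ) (x : EuclideanSpace ℝ (Fin d)) (s : ℝ) :
    0 ≤ jb d x ^ s := Real.rpow_nonneg (Real.sqrt_nonneg _) s

lemma measurable_jb (d : ℕ) : Measurable (jb d) := by
  unfold jb
  fun_prop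

lemma measurable_Kker (d : ℕ) (α : ℝ) (ξ : EuclideanSpace ℝ (Fin d)) :
    Measurable (fun η => Kker d α ξ η) := by
  have h := measurable_jb d
  unfold Kker Pperp
  fun_prop

lemma Kker_nonneg (d : ℕ) (α : ℝ) (ξ η : EuclideanSpace ℝ (Fin d)) : 0 ≤ Kker d α ξ η :=
  mul_nonneg (sq_nonneg _) (jb_rpow_nonneg _ _ _)

lemma Kker_le (d : ℕ) (α : ℝ) (ξ η : EuclideanSpace ℝ (Fin d)) :
    Kker d α ξ η ≤ ‖ξ‖ ^ 2 * jb d (ξ - η) ^ (-((d : ℝ) + 2 * α)) :=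
  mul_le_mul_of_nonneg_right (Pperp_norm_sq_le _ _ _) (jb_rpow_nonneg _ _ _)

lemma Kker_le' (d : ℕ) {α : ℝ} (hα : 0 < α) (ξ η : EuclideanSpace ℝ (Fin d)) :
    Kker d α ξ η ≤ ‖ξ‖ ^ 2 :=
  (Kker_le d α ξ η).trans (mul_le_of_le_one_right (sq_nonneg _)
    (jb_rpow_le_one _ _ (by have : (0 : ℝ) ≤ d := Nat.cast_nonneg d; linarith)))

lemma integrable_Kker (d : ℕ) {α : ℝ} (hα : 0 < α) (ξ : EuclideanSpace ℝ (Fin d)) :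
    Integrable (fun η => Kker d α ξ η) := by
  have h0 : Integrable (fun x : EuclideanSpace ℝ (Fin d) =>
      jb d x ^ (-((d : ℝ) + 2 * α))) := by
    have := integrable_rpow_neg_one_add_norm_sq (E := EuclideanSpace ℝ (Fin d))
      (μ := volume) (r := (d : ℝ) + 2 * α) (by simp; linarith)
    refine this.congr (Filter.Eventually.of_forall fun x => ?_)
    simp only [jb]
    rw [Real.sqrt_eq_rpow, ← Real.rpow_mul (by positivity)]
    congr 1
    ring
  refine ((h0.comp_sub_left ξ).const_mul (‖ξ‖ ^ 2)).mono'
    (measurable_Kker d α ξ).aestronglyMeasurable (Filter.Eventually.of_forall fun η => ?_)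
  rw [Real.norm_of_nonneg (Kker_nonneg _ _ _ _)]
  exact Kker_le d α ξ η

lemma integrable_Kker_mul (d : ℕ) (hd : 2 ≤ d) {α δ : ℝ} (hα : 0 < α) (hδ : δ < 1)
    (ξ : EuclideanSpace ℝ (Fin d)) (g : EuclideanSpace ℝ (Fin d) → ℝ) (hg : Measurable g)
    (C : ℝ) (hC : ∀ η, |g η| ≤
      (Metric.closedBall (0 : EuclideanSpace ℝ (Fin d)) 1).indicator
        (fun η => ‖η‖ ^ (-(2 * δ))) η + C) :
    Integrable (fun η => Kker d α ξ η * g η) := by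
  have hd' : (2 : ℝ) ≤ d := by exact_mod_cast hd
  have hloc : LocallyIntegrable (fun η : EuclideanSpace ℝ (Fin d) => ‖η‖ ^ (-(2 * δ)))
      volume := by
    refine locallyIntegrable_of_norm_le_rpow (C := 1) (α := 2 * δ) ?_ ?_ ?_ ?_
    · simp; omega
    · simp; linarith
    · refine Filter.Eventually.of_forall fun x => ?_
      rw [one_mul, Real.norm_of_nonneg (by positivity)]
    · exact Measurable.aestronglyMeasurable (by fun_prop)
  have hball := (hloc.integrableOn_isCompact
    (isCompact_closedBall (0 : EuclideanSpace ℝ (Fin d)) 1)).integrable_indicator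
      measurableSet_closedBall
  refine ((hball.const_mul (‖ξ‖ ^ 2)).add ((integrable_Kker d hα ξ).const_mul C)).mono'
    ((measurable_Kker d α ξ).mul hg).aestronglyMeasurable
    (Filter.Eventually.of_forall fun η => ?_)
  rw [norm_mul, Real.norm_of_nonneg (Kker_nonneg _ _ _ _), Real.norm_eq_abs]
  have hi : 0 ≤ (Metric.closedBall (0 : EuclideanSpace ℝ (Fin d)) 1).indicator
        (fun η => ‖η‖ ^ (-(2 * δ))) η := Set.indicator_nonneg (fun _ _ => by positivity) _
  have h1 := mul_le_mul_of_nonneg_left (hC η) (Kker_nonneg d α ξ η)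
  have h2 := mul_le_mul_of_nonneg_right (Kker_le' d hα ξ η) hi
  simp only [Pi.add_apply]
  linarith

lemma norm_rpow_le (d : ℕ) {δ : ℝ} (hδ : 0 < δ) (η : EuclideanSpace ℝ (Fin d)) :
    ‖η‖ ^ (-(2 * δ)) ≤ (Metric.closedBall (0 : EuclideanSpace ℝ (Fin d)) 1).indicator
        (fun η => ‖η‖ ^ (-(2 * δ))) η + 1 := by
  by_cases h : η ∈ Metric.closedBall (0 : EuclideanSpace ℝ (Fin d)) 1
  · rw [Set.indicator_of_mem h]; linarith
  · rw [Set.indicator_of_notMem h, zero_add]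
    simp only [Metric.mem_closedBall, dist_zero_right, not_le] at h
    exact Real.rpow_le_one_of_one_le_of_nonpos h.le (by linarith)

lemma abs_cut_le {a b A c : ℝ} (ha : a ∈ Set.Icc (0 : ℝ) 1) (hb : 0 ≤ b) (h : b ≤ A + 1) :
    |a * b - c| ≤ A + (1 + |c|) := by
  have h1 : a * b ≤ b := mul_le_of_le_one_left hb ha.2
  have h2 : 0 ≤ a * b := mul_nonneg ha.1 hb
  calc |a * b - c| ≤ |a * b| + |c| := abs_sub _ _
    _ ≤ A + (1 + |c|) := by rw [abs_of_nonneg h2]; linarith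

theorem stmt0 (d : ℕ) (hd : 2 ≤ d) (α δ : ℝ)
    (hα : α ∈ Set.Ioo (0 : ℝ) (1 / 2)) (hδ : δ ∈ Set.Ioo (0 : ℝ) 1)
    (φ : ℝ → ℝ)
    (hφ_smooth : ContDiffOn ℝ (⊤ : ℕ∞) φ (Set.Ici 0))
    (hφ_anti : AntitoneOn φ (Set.Ici 0))
    (hφ_range : ∀ r : ℝ, 0 ≤ r → φ r ∈ Set.Icc (0 : ℝ) 1)
    (hφ_one : ∀ r ∈ Set.Icc (0 : ℝ) 1, φ r = 1)
    (hφ_zero : ∀ r : ℝ, 2 ≤ r → φ r = 0) :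
    -- integrability of the integrand defining `F^n`
    (∀ ξ : EuclideanSpace ℝ (Fin d), ∀ n : ℕ, 1 ≤ n →
      Integrable (fun η : EuclideanSpace ℝ (Fin d) =>
        Kker d α ξ η *
          (phin φ n ‖η‖ * jb d η ^ (-(2 * δ)) - phin φ n ‖ξ‖ * jb d ξ ^ (-(2 * δ))))) ∧
    -- the same with `φ_n` replaced by the constant `1`, i.e. the integrand defining `F`
    (∀ ξ : EuclideanSpace ℝ (Fin d),
      Integrable (fun η : EuclideanSpace ℝ (Fin d) =>
        Kker d α ξ η * (jb d η ^ (-(2 * δ)) - jb d ξ ^ (-(2 * δ))))) ∧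
    -- integrability of the integrand defining `Ḟ^n`, for `ξ ≠ 0`
    (∀ ξ : EuclideanSpace ℝ (Fin d), ξ ≠ 0 → ∀ n : ℕ, 1 ≤ n →
      Integrable (fun η : EuclideanSpace ℝ (Fin d) =>
        Kker d α ξ η *
          (phin φ n ‖η‖ * ‖η‖ ^ (-(2 * δ)) - phin φ n ‖ξ‖ * ‖ξ‖ ^ (-(2 * δ))))) ∧
    -- the same with `φ_n` replaced by the constant `1`, i.e. the integrand defining `Ḟ`
    (∀ ξ : EuclideanSpace ℝ (Fin d), ξ ≠ 0 →
      Integrable (fun η : EuclideanSpace ℝ (Fin d) =>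
        Kker d α ξ η * (‖η‖ ^ (-(2 * δ)) - ‖ξ‖ ^ (-(2 * δ))))) := by
  obtain ⟨hα0, -⟩ := hα
  obtain ⟨hδ0, hδ1⟩ := hδ
  have hcut : ∀ n : ℕ, ∀ r : ℝ, 0 ≤ r → phin φ n r ∈ Set.Icc (0 : ℝ) 1 := fun n r hr =>
    hφ_range _ (by positivity)
  have hcutm : ∀ n : ℕ, Measurable (fun η : EuclideanSpace ℝ (Fin d) => phin φ n ‖η‖) := by
    intro n
    refine Continuous.measurable ?_
    exact hφ_smooth.continuousOn.comp_continuous (by fun_prop)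
      (fun x => Set.mem_Ici.2 (by positivity))
  have hjm := measurable_jb d
  have hjb : ∀ η : EuclideanSpace ℝ (Fin d), jb d η ^ (-(2 * δ)) ≤
      (Metric.closedBall (0 : EuclideanSpace ℝ (Fin d)) 1).indicator
        (fun η => ‖η‖ ^ (-(2 * δ))) η + 1 := fun η => by
    have h1 := jb_rpow_le_one d η (s := -(2 * δ)) (by linarith)
    have h2 : 0 ≤ (Metric.closedBall (0 : EuclideanSpace ℝ (Fin d)) 1).indicator
        (fun η => ‖η‖ ^ (-(2 * δ))) η := Set.indicator_nonneg (fun _ _ => by positivity) _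
    linarith
  have h1 : (1 : ℝ) ∈ Set.Icc (0 : ℝ) 1 := by simp
  refine ⟨fun ξ n _ => ?_, fun ξ => ?_, fun ξ _ n _ => ?_, fun ξ _ => ?_⟩
  · have := hcutm n
    exact integrable_Kker_mul d hd hα0 hδ1 ξ _ (by fun_prop) _ fun η =>
      abs_cut_le (hcut n _ (norm_nonneg η)) (jb_rpow_nonneg _ _ _) (hjb η)
  · exact integrable_Kker_mul d hd hα0 hδ1 ξ _ (by fun_prop) _ fun η => by
      simpa only [one_mul] using abs_cut_le (c := jb d ξ ^ (-(2 * δ))) h1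
        (jb_rpow_nonneg d η _) (hjb η)
  · have := hcutm n
    exact integrable_Kker_mul d hd hα0 hδ1 ξ _ (by fun_prop) _ fun η =>
      abs_cut_le (hcut n _ (norm_nonneg η)) (by positivity) (norm_rpow_le d hδ0 η)
  · exact integrable_Kker_mul d hd hα0 hδ1 ξ _ (by fun_prop) _ fun η => by
      simpa only [one_mul] using abs_cut_le (c := ‖ξ‖ ^ (-(2 * δ))) h1
        (by positivity) (norm_rpow_le d hδ0 η)

end
end

section
/- There exists a finite constant C depending only on d, α and δ such that for every r > 0 and every ξ ∈ ℝ^d with |ξ| ≥ 2r one has ∫_{0 < |η| ≤ r} |P⊥_{ξ−η} η|² ⟨ξ−η⟩^{−(d+2α)} |η|^{−2δ} dη ≤ C r^{d+2−2δ} ⟨ξ⟩^{−(d+2α)}. -/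
open MeasureTheory Real

noncomputable section

lemma Pperp_norm_le (d : ℕ) (v w : EuclideanSpace ℝ (Fin d)) : ‖Pperp d v w‖ ≤ ‖w‖ := by
  have h : ‖Pperp d v w‖ ^ 2 ≤ ‖w‖ ^ 2 := by
    unfold Pperp
    rw [norm_sub_sq_real, norm_smul, real_inner_smul_right, real_inner_comm v w, mul_pow,
      Real.norm_eq_abs, sq_abs]
    rcases eq_or_ne v 0 with rfl | hv
    · simp
    · have hv' : ‖v‖ ≠ 0 := norm_ne_zero_iff.mpr hv
      have : (inner ℝ v w / ‖v‖ ^ 2) ^ 2 * ‖v‖ ^ 2 = inner ℝ v w / ‖v‖ ^ 2 * inner ℝ v w := by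
        field_simp
      have h2 : 0 ≤ inner ℝ v w / ‖v‖ ^ 2 * inner ℝ v w := by
        rw [← this]; positivity
      first
        | linarith
        | (rw [real_inner_comm v w] at *; linarith)
  exact (sq_le_sq₀ (norm_nonneg _) (norm_nonneg _)).mp h

lemma jb_half_le (d : ℕ) (r : ℝ) (ξ η : EuclideanSpace ℝ (Fin d)) (h : 2 * r ≤ ‖ξ‖)
    (hη : ‖η‖ ≤ r) : jb d ξ / 2 ≤ jb d (ξ - η) := by
  unfold jb
  have h1 : ‖ξ‖ - ‖η‖ ≤ ‖ξ - η‖ := norm_sub_norm_le ξ η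
  have h2 : ‖ξ‖ / 2 ≤ ‖ξ - η‖ := by linarith
  apply Real.le_sqrt_of_sq_le
  rw [div_pow, Real.sq_sqrt (by positivity)]
  nlinarith [norm_nonneg ξ, norm_nonneg (ξ - η)]

/-- There exists a finite constant `C = C(d,α,δ)` such that for every `r > 0` and every
`ξ ∈ ℝ^d` with `|ξ| ≥ 2r`,
`∫_{0<|η|≤r} |P⊥_{ξ−η} η|² ⟨ξ−η⟩^{−(d+2α)} |η|^{−2δ} dη ≤ C r^{d+2−2δ} ⟨ξ⟩^{−(d+2α)}`. -/
theorem stmt4 (d : ℕ) (hd : 2 ≤ d) (α δ : ℝ)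
    (hα : α ∈ Set.Ioo (0 : ℝ) (1 / 2)) (hδ : δ ∈ Set.Ioo (0 : ℝ) 1) :
    ∃ C : ℝ, 0 ≤ C ∧
      ∀ r : ℝ, 0 < r → ∀ ξ : EuclideanSpace ℝ (Fin d), 2 * r ≤ ‖ξ‖ →
        (∫ η in {η : EuclideanSpace ℝ (Fin d) | 0 < ‖η‖ ∧ ‖η‖ ≤ r},
            ‖Pperp d (ξ - η) η‖ ^ 2 * jb d (ξ - η) ^ (-((d : ℝ) + 2 * α)) *
              ‖η‖ ^ (-(2 * δ)))
          ≤ C * r ^ ((d : ℝ) + 2 - 2 * δ) * jb d ξ ^ (-((d : ℝ) + 2 * α)) := by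
  obtain ⟨hα0, hα1⟩ := hα
  obtain ⟨hδ0, hδ1⟩ := hδ
  refine ⟨2 ^ ((d : ℝ) + 2 * α) *
    (volume : Measure (EuclideanSpace ℝ (Fin d))).real (Metric.closedBall 0 1), by positivity, ?_⟩
  intro r hr ξ hξ
  have hs : 0 ≤ (d : ℝ) + 2 * α := by positivity
  have hjpos : 0 < jb d ξ := by unfold jb; positivity
  set S : Set (EuclideanSpace ℝ (Fin d)) := {η | 0 < ‖η‖ ∧ ‖η‖ ≤ r} with hS
  have hsub : S ⊆ Metric.closedBall 0 r := fun η hη => by simpa using hη.2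
  have hfin : volume (Metric.closedBall (0 : EuclideanSpace ℝ (Fin d)) r) < ⊤ :=
    measure_closedBall_lt_top
  have hSfin : volume S < ⊤ := (measure_mono hsub).trans_lt hfin
  set K : ℝ := r ^ (2 - 2 * δ) * (2 ^ ((d : ℝ) + 2 * α) * jb d ξ ^ (-((d : ℝ) + 2 * α))) with hK
  have hK0 : 0 ≤ K := by positivity
  have hbound : ∀ η ∈ S, ‖‖Pperp d (ξ - η) η‖ ^ 2 * jb d (ξ - η) ^ (-((d : ℝ) + 2 * α)) *
              ‖η‖ ^ (-(2 * δ))‖ ≤ K := by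
    rintro η ⟨hη0, hηr⟩
    have hj0 : 0 ≤ jb d (ξ - η) := Real.sqrt_nonneg _
    rw [Real.norm_of_nonneg (by positivity)]
    have h1 : ‖Pperp d (ξ - η) η‖ ^ 2 * ‖η‖ ^ (-(2 * δ)) ≤ r ^ (2 - 2 * δ) := by
      calc ‖Pperp d (ξ - η) η‖ ^ 2 * ‖η‖ ^ (-(2 * δ))
          ≤ ‖η‖ ^ 2 * ‖η‖ ^ (-(2 * δ)) := by
            gcongr
            exact Pperp_norm_le d _ _
        _ = ‖η‖ ^ (2 - 2 * δ) := by
            rw [← Real.rpow_natCast, ← Real.rpow_add hη0]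
            norm_num [sub_eq_add_neg]
        _ ≤ r ^ (2 - 2 * δ) := Real.rpow_le_rpow hη0.le hηr (by linarith)
    have h2 : jb d (ξ - η) ^ (-((d : ℝ) + 2 * α)) ≤
        2 ^ ((d : ℝ) + 2 * α) * jb d ξ ^ (-((d : ℝ) + 2 * α)) := by
      calc jb d (ξ - η) ^ (-((d : ℝ) + 2 * α))
          ≤ (jb d ξ / 2) ^ (-((d : ℝ) + 2 * α)) :=
            Real.rpow_le_rpow_of_nonpos (by positivity) (jb_half_le d r ξ η hξ hηr) (by linarith)
        _ = _ := by
            rw [Real.div_rpow hjpos.le (by norm_num), Real.rpow_neg (by norm_num : (0:ℝ) ≤ 2),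
              div_inv_eq_mul, mul_comm]
    calc _ = (‖Pperp d (ξ - η) η‖ ^ 2 * ‖η‖ ^ (-(2 * δ))) *
            jb d (ξ - η) ^ (-((d : ℝ) + 2 * α)) := by ring
      _ ≤ K := mul_le_mul h1 h2 (by positivity) (by positivity)
  have hmain := norm_setIntegral_le_of_norm_le_const hSfin hbound
  have hvol : (volume : Measure (EuclideanSpace ℝ (Fin d))).real S ≤
      r ^ (d : ℝ) * (volume : Measure (EuclideanSpace ℝ (Fin d))).real (Metric.closedBall 0 1) := by
    refine (measureReal_mono hsub hfin.ne).trans (le_of_eq ?_)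
    rw [Measure.addHaar_real_closedBall' _ _ hr.le, finrank_euclideanSpace_fin, Real.rpow_natCast]
  refine (le_abs_self _).trans (hmain.trans ((mul_le_mul_of_nonneg_left hvol hK0).trans
    (le_of_eq ?_)))
  have : r ^ ((d : ℝ) + 2 - 2 * δ) = r ^ (d : ℝ) * r ^ (2 - 2 * δ) := by
    rw [← Real.rpow_add hr]; congr 1; ring
  rw [this, hK]
  ring

end
end
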